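/- arXiv:2507.08755 — 3 statements merged into one kernel-verified Lean document; each statement's English description precedes it below -/
import Mathlib

section
/- Assume the subgroup construction with 2 ≤ k ≤ n−1 and λ ∉ H. Then every k columns of G_1(b,c,∞) are linearly independent; that is, C_1(b,c,∞) is an MDS code of length n+1, dimension k, and minimum Hamming distance n − k + 2. -/
open Matrix Finset

/-- The `k × (m+1)` one-column-twisted generator matrix `G_1(b,c)`:
columns `0,…,m-1` are `(a_j^s)_s`, last column is `(b^s - λ c^s)_s`. -/
def G1mat {F : Type*} [Field F] (k m : ℕ) (a : Fin m → F) (b c lam : F) :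
    Matrix (Fin k) (Fin (m + 1)) F :=
  Matrix.of fun s j =>
    if h : (j : ℕ) < m then a ⟨j, h⟩ ^ (s : ℕ)
    else b ^ (s : ℕ) - lam * c ^ (s : ℕ)

/-- The extended matrix `G_1(b,c,∞)`, with the extra column `(0,…,0,1)ᵀ`. -/
def G1matInf {F : Type*} [Field F] (k m : ℕ) (a : Fin m → F) (b c lam : F) :
    Matrix (Fin k) (Fin (m + 2)) F :=
  Matrix.of fun s j =>
    if h : (j : ℕ) < m then a ⟨j, h⟩ ^ (s : ℕ)
    else if (j : ℕ) = m then b ^ (s : ℕ) - lam * c ^ (s : ℕ)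
    else if (s : ℕ) = k - 1 then 1 else 0

/-- The `k × (m+2)` two-column-twisted generator matrix `G_2(b,c)`. -/
def G2mat {F : Type*} [Field F] (k m : ℕ) (a : Fin m → F) (b c l1 l2 : F) :
    Matrix (Fin k) (Fin (m + 2)) F :=
  Matrix.of fun s j =>
    if h : (j : ℕ) < m then a ⟨j, h⟩ ^ (s : ℕ)
    else if (j : ℕ) = m then b ^ (s : ℕ) - l1 * c ^ (s : ℕ)
    else b ^ (s : ℕ) - l2 * c ^ (s : ℕ)

/-- The extended matrix `G_2(b,c,∞)`, with the extra column `(0,…,0,1)ᵀ`. -/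
def G2matInf {F : Type*} [Field F] (k m : ℕ) (a : Fin m → F) (b c l1 l2 : F) :
    Matrix (Fin k) (Fin (m + 3)) F :=
  Matrix.of fun s j =>
    if h : (j : ℕ) < m then a ⟨j, h⟩ ^ (s : ℕ)
    else if (j : ℕ) = m then b ^ (s : ℕ) - l1 * c ^ (s : ℕ)
    else if (j : ℕ) = m + 1 then b ^ (s : ℕ) - l2 * c ^ (s : ℕ)
    else if (s : ℕ) = k - 1 then 1 else 0

/-- The code generated by a matrix: the span of its rows. -/
def rowSpan {F : Type*} [Field F] {k N : ℕ} (G : Matrix (Fin k) (Fin N) F) :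
    Submodule F (Fin N → F) :=
  Submodule.span F (Set.range fun s => G s)

/-- Every `k` columns of the `k × N` matrix `G` are linearly independent. -/
def colsIndep {F : Type*} [Field F] {k N : ℕ} (G : Matrix (Fin k) (Fin N) F) : Prop :=
  ∀ e : Fin k → Fin N, Function.Injective e → (G.submatrix id e).det ≠ 0

/-- Minimum Hamming distance (= minimum Hamming weight) of a linear code. -/
noncomputable def minDist {F : Type*} [Field F] [DecidableEq F] {N : ℕ}
    (C : Submodule F (Fin N → F)) : ℕ :=
  sInf {d | ∃ x ∈ C, x ≠ 0 ∧ hammingNorm x = d}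

/-- The Schur (componentwise) product of two linear codes. -/
def schurMul {F : Type*} [Field F] {N : ℕ} (C D : Submodule F (Fin N → F)) :
    Submodule F (Fin N → F) :=
  Submodule.span F {x | ∃ c ∈ C, ∃ d ∈ D, x = c * d}

/-- The Reed–Solomon code `RS_{k,N}(a)`. -/
def RSCode {F : Type*} [Field F] (k N : ℕ) (a : Fin N → F) : Submodule F (Fin N → F) :=
  Submodule.span F
    {x | ∃ f : Polynomial F, f.degree < (k : WithBot ℕ) ∧ x = fun j => f.eval (a j)}

/-- The extended Reed–Solomon code `RS_{k,n-1}(a,∞)` of total length `n`. -/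
def RSextCode {F : Type*} [Field F] (k n : ℕ) (a : Fin (n - 1) → F) :
    Submodule F (Fin n → F) :=
  Submodule.span F
    {x | ∃ f : Polynomial F, f.degree < (k : WithBot ℕ) ∧
      x = fun j : Fin n =>
        if h : (j : ℕ) < n - 1 then f.eval (a ⟨j, h⟩) else f.coeff (k - 1)}

/-- Equivalence of linear codes: equal up to a permutation of coordinates and
multiplication by nonzero scalars in each coordinate. -/
def codeEquiv {F : Type*} [Field F] {N : ℕ} (C D : Submodule F (Fin N → F)) : Prop :=
  ∃ π : Equiv.Perm (Fin N), ∃ v : Fin N → F, (∀ i, v i ≠ 0) ∧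
    (C : Set (Fin N → F)) =
      (fun x : Fin N → F => fun i => v i * x (π i)) '' (D : Set (Fin N → F))

/-- The dual code with respect to the standard bilinear form. -/
def dualCode {F : Type*} [Field F] {N : ℕ} (C : Submodule F (Fin N → F)) :
    Submodule F (Fin N → F) where
  carrier := {y | ∀ x ∈ C, ∑ i, x i * y i = 0}
  add_mem' := by
    intro y z hy hz x hx
    have hy' := hy x hx
    have hz' := hz x hx
    simp only [Set.mem_setOf_eq, Pi.add_apply, mul_add, Finset.sum_add_distrib, hy', hz',
      add_zero]
  zero_mem' := by intro x hx; simp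
  smul_mem' := by
    intro c y hy x hx
    have h := hy x hx
    simp only [Set.mem_setOf_eq, Pi.smul_apply, smul_eq_mul, mul_left_comm, ← Finset.mul_sum,
      h, mul_zero]

open Polynomial in
/-- If `f(b) = λ f(c)` and `b - a_i = μ_i (c - a_i) ≠ 0` with all `μ_i` in a subgroup avoiding `λ`,
then `f` has fewer than `natDegree f` roots among the `a_i`. -/
theorem card_lt_natDegree_of_eval_eq_mul_eval {F ι : Type*} [Field F] (H : Subgroup Fˣ)
    (μ : ι → Fˣ) (hμH : ∀ i, μ i ∈ H) {b c lam : F} (hlam : ∀ u : Fˣ, u ∈ H → (u : F) ≠ lam)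
    {a : ι → F} (hainj : Function.Injective a) (hab : ∀ i, b - a i = μ i * (c - a i))
    (hac : ∀ i, c - a i ≠ 0) {f : F[X]} (hf : f ≠ 0) (hbc : f.eval b = lam * f.eval c)
    {Z : Finset ι} (hZ : ∀ i ∈ Z, f.eval (a i) = 0) : #Z < f.natDegree := by
  have hdvd : ∏ i ∈ Z, (X - C (a i)) ∣ f :=
    Finset.prod_dvd_of_coprime
      (fun i _ j _ hij => pairwise_coprime_X_sub_C hainj hij)
      fun i hi => dvd_iff_isRoot.2 (hZ i hi)
  obtain ⟨g, rfl⟩ := hdvd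
  have hg : g ≠ 0 := right_ne_zero_of_mul hf
  have hdeg : ((∏ i ∈ Z, (X - C (a i))) * g).natDegree = #Z + g.natDegree := by
    rw [natDegree_mul (left_ne_zero_of_mul hf) hg, natDegree_finsetProd_X_sub_C_eq_card]
  rw [hdeg]
  by_contra hlt
  obtain ⟨u, rfl⟩ := natDegree_eq_zero.1 (by omega : g.natDegree = 0)
  have hu : u ≠ 0 := by simpa using hg
  simp only [eval_mul, eval_prod, eval_sub, eval_X, eval_C, hab, Finset.prod_mul_distrib] at hbc
  have hP : ∏ i ∈ Z, (c - a i) ≠ 0 := Finset.prod_ne_zero_iff.2 fun i _ => hac i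
  refine hlam (∏ i ∈ Z, μ i) (Subgroup.prod_mem _ fun i _ => hμH i) ?_
  rw [Units.coe_prod]
  refine mul_right_cancel₀ (mul_ne_zero hP hu) ?_
  rw [← hbc, mul_assoc]

/-- Every `k` columns are independent iff each nontrivial combination of the rows has fewer than
`k` zero coordinates. -/
theorem colsIndep_iff_card_zeros_lt {F : Type*} [Field F] [DecidableEq F] {k N : ℕ}
    (G : Matrix (Fin k) (Fin N) F) :
    colsIndep G ↔ ∀ v : Fin k → F, v ≠ 0 → #{j | (v ᵥ* G) j = 0} < k := by
  constructor
  · intro h v hv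
    by_contra! hk
    obtain ⟨t, hts, htk⟩ := Finset.exists_subset_card_eq hk
    let e := t.orderEmbOfFin htk
    refine hv (Matrix.eq_zero_of_vecMul_eq_zero (h e e.injective) (funext fun i => ?_))
    exact (Finset.mem_filter.1 (hts (t.orderEmbOfFin_mem htk i))).2
  · intro h e he hdet
    obtain ⟨v, hv, hvG⟩ := Matrix.exists_vecMul_eq_zero_iff.2 hdet
    refine (h v hv).not_ge ?_
    calc k = #(Finset.univ.image e) := by simp [Finset.card_image_of_injective _ he]
      _ ≤ _ := Finset.card_le_card fun j hj => by
        obtain ⟨i, -, rfl⟩ := Finset.mem_image.1 hj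
        exact Finset.mem_filter.2 ⟨Finset.mem_univ _, congrFun hvG i⟩

theorem mem_rowSpan_iff {F : Type*} [Field F] {k N : ℕ} {G : Matrix (Fin k) (Fin N) F}
    {x : Fin N → F} : x ∈ rowSpan G ↔ ∃ v : Fin k → F, v ᵥ* G = x := by
  simp only [rowSpan, Submodule.mem_span_range_iff_exists_fun, Matrix.vecMul_eq_sum]

theorem colsIndep.finrank_rowSpan {F : Type*} [Field F] {k N : ℕ} {G : Matrix (Fin k) (Fin N) F}
    (hG : colsIndep G) (hkN : k ≤ N) : Module.finrank F (rowSpan G) = k := by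
  have hrows : LinearIndependent F G.row :=
    Matrix.vecMul_injective_iff.1 <|
      (injective_iff_map_eq_zero G.vecMulLinear).2 fun v hv =>
        Matrix.eq_zero_of_vecMul_eq_zero (hG _ (Fin.castLE_injective hkN))
          (funext fun i => congrFun hv (Fin.castLE hkN i))
  exact (finrank_span_eq_card hrows).trans (Fintype.card_fin k)

theorem colsIndep.minDist_rowSpan {F : Type*} [Field F] [DecidableEq F] {k N : ℕ}
    {G : Matrix (Fin k) (Fin N) F} (hG : colsIndep G) (hk : 0 < k) (hkN : k ≤ N) :
    minDist (rowSpan G) = N - k + 1 := by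
  have hweight (x : Fin N → F) : #{j | x j = 0} + hammingNorm x = N := by
    simpa [hammingNorm] using
      Finset.card_filter_add_card_filter_not (s := Finset.univ) (fun j => x j = 0)
  have hlower : ∀ x ∈ rowSpan G, x ≠ 0 → N - k + 1 ≤ hammingNorm x := by
    intro x hx hx0
    obtain ⟨v, rfl⟩ := mem_rowSpan_iff.1 hx
    have hv : v ≠ 0 := by
      rintro rfl
      simp at hx0
    have := (colsIndep_iff_card_zeros_lt G).1 hG v hv
    have := hweight (v ᵥ* G)
    omega
  let M := G.submatrix id (Fin.castLE hkN)
  let l : Fin k := ⟨k - 1, by omega⟩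
  obtain ⟨v, hv⟩ : ∃ v, v ᵥ* M = Pi.single l 1 :=
    ⟨Pi.single l 1 ᵥ* M⁻¹, by
      rw [Matrix.vecMul_vecMul, Matrix.nonsing_inv_mul _
        (hG _ (Fin.castLE_injective hkN)).isUnit, Matrix.vecMul_one]⟩
  have hcoord (i : Fin k) : (v ᵥ* G) (Fin.castLE hkN i) = Pi.single (M := fun _ => F) l 1 i :=
    congrFun hv i
  have hne : v ᵥ* G ≠ 0 := fun h0 => by simpa [h0] using hcoord l
  have hzeros : k - 1 ≤ #{j | (v ᵥ* G) j = 0} := by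
    calc k - 1 = #((Finset.univ.erase l).image (Fin.castLE hkN)) := by
          simp [Finset.card_image_of_injective _ (Fin.castLE_injective hkN)]
      _ ≤ _ := Finset.card_le_card fun j hj => by
        obtain ⟨i, hi, rfl⟩ := Finset.mem_image.1 hj
        simp [hcoord, (Finset.mem_erase.1 hi).1]
  have hmem : v ᵥ* G ∈ rowSpan G := mem_rowSpan_iff.2 ⟨v, rfl⟩
  refine IsLeast.csInf_eq ⟨⟨v ᵥ* G, hmem, hne, ?_⟩, ?_⟩
  · have := hlower _ hmem hne
    have := hweight (v ᵥ* G)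
    omega
  · rintro d ⟨x, hx, hx0, rfl⟩
    exact hlower x hx hx0

open Polynomial in
/-- The subgroup construction yields a matrix all of whose `k`-sets of columns are independent. -/
theorem colsIndep_G1matInf {F : Type*} [Field F] {m k : ℕ} (hk : 2 ≤ k)
    (H : Subgroup Fˣ) (μ : Fin m → Fˣ) (hμH : ∀ i, μ i ∈ H) {b c lam : F}
    (hlam : ∀ u : Fˣ, u ∈ H → (u : F) ≠ lam) {a : Fin m → F} (hainj : Function.Injective a)
    (hab : ∀ i, b - a i = μ i * (c - a i)) (hac : ∀ i, c - a i ≠ 0) :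
    colsIndep (G1matInf k m a b c lam) := by
  classical
  refine (colsIndep_iff_card_zeros_lt _).2 fun v hv => ?_
  let f : F[X] := ∑ s : Fin k, C (v s) * X ^ (s : ℕ)
  have heval (x : F) : f.eval x = ∑ s : Fin k, v s * x ^ (s : ℕ) := by
    simp [f, eval_finsetSum]
  have hcoeff (s : Fin k) : f.coeff s = v s := by
    simp [f, coeff_X_pow, Fin.val_inj]
  have hf : f ≠ 0 := fun h0 => hv (funext fun s => by simp [← hcoeff, h0])
  have hdeg : f.natDegree < k :=
    (natDegree_lt_iff_degree_lt hf).2 (degree_sum_fin_lt v)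
  have hcol (j : Fin m) :
      (v ᵥ* G1matInf k m a b c lam) j.castSucc.castSucc = f.eval (a j) := by
    simp [Matrix.vecMul, dotProduct, G1matInf, heval]
  have htwist : (v ᵥ* G1matInf k m a b c lam) (Fin.last m).castSucc
      = f.eval b - lam * f.eval c := by
    simp only [Matrix.vecMul, dotProduct, G1matInf, heval, Finset.mul_sum,
      ← Finset.sum_sub_distrib]
    exact Finset.sum_congr rfl fun s _ => by simp; ring
  have hinf : (v ᵥ* G1matInf k m a b c lam) (Fin.last (m + 1)) = f.coeff (k - 1) := by
    have hl : k - 1 < k := by omega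
    rw [show f.coeff (k - 1) = v ⟨k - 1, hl⟩ from hcoeff ⟨k - 1, hl⟩]
    simp only [Matrix.vecMul, dotProduct, G1matInf]
    rw [Finset.sum_eq_single ⟨k - 1, hl⟩] <;> simp +contextual [Fin.ext_iff]
  have hZ : #{j | f.eval (a j) = 0} ≤ f.natDegree := by
    rw [← Finset.card_image_of_injective _ hainj]
    refine card_le_degree_of_subset_roots fun x hx => ?_
    obtain ⟨j, hj, rfl⟩ := Finset.mem_image.1 (Finset.mem_val ▸ hx)
    exact (mem_roots hf).2 (Finset.mem_filter.1 hj).2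
  have hZ' (h : f.eval b - lam * f.eval c = 0) : #{j | f.eval (a j) = 0} < f.natDegree :=
    card_lt_natDegree_of_eval_eq_mul_eval H μ hμH hlam hainj hab hac hf (sub_eq_zero.1 h)
      fun j hj => (Finset.mem_filter.1 hj).2
  have hdeg' (h : f.coeff (k - 1) = 0) : f.natDegree ≠ k - 1 := fun h' =>
    hf (leadingCoeff_eq_zero.1 (by rwa [leadingCoeff, h']))
  rw [Finset.card_filter, Fin.sum_univ_castSucc, Fin.sum_univ_castSucc]
  simp only [hcol, htwist, hinf]
  rw [← Finset.card_filter]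
  split_ifs with h₁ h₂ h₂
  · have := hZ' h₁
    have := hdeg' h₂
    omega
  · have := hZ' h₁
    omega
  · have := hdeg' h₂
    omega
  · omega

/-- Subgroup construction (`n = m+1`): `H ≤ Fˣ`, the `μ_i` are pairwise
distinct elements of `H \ {1}`, `b ≠ c`, `a_i = (b - μ_i c)/(1 - μ_i)`, and `λ ∉ H`.
Then for `2 ≤ k ≤ n-1` every `k` columns of `G_1(b,c,∞)` are linearly independent;
that is, `C_1(b,c,∞)` is an MDS code of length `n+1`, dimension `k`, and minimum
Hamming distance `n - k + 2`. -/
theorem C1inf_subgroup_MDS {F : Type*} [Field F] [Fintype F] [DecidableEq F] (m k : ℕ)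
    (hk1 : 2 ≤ k) (hkm : k ≤ m)
    (H : Subgroup Fˣ) (μ : Fin m → Fˣ)
    (hμH : ∀ i, μ i ∈ H) (hμ1 : ∀ i, μ i ≠ 1) (hμinj : Function.Injective μ)
    (b c lam : F) (hbc : b ≠ c)
    (hlam : ∀ u : Fˣ, u ∈ H → (u : F) ≠ lam)
    (a : Fin m → F) (ha : ∀ i, a i = (b - (μ i : F) * c) / (1 - (μ i : F))) :
    colsIndep (G1matInf k m a b c lam) ∧
      Module.finrank F (rowSpan (G1matInf k m a b c lam)) = k ∧
      minDist (rowSpan (G1matInf k m a b c lam)) = (m + 2) - k + 1 := by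
  have hμ (i : Fin m) : 1 - (μ i : F) ≠ 0 :=
    sub_ne_zero.2 fun h => hμ1 i (Units.ext h.symm)
  have hca (i : Fin m) : c - a i = (c - b) / (1 - (μ i : F)) := by
    have := hμ i
    rw [ha]
    field_simp
    ring
  have hab (i : Fin m) : b - a i = μ i * (c - a i) := by
    have := hμ i
    rw [hca, ha]
    field_simp
    ring
  have hac (i : Fin m) : c - a i ≠ 0 := by
    rw [hca]
    exact div_ne_zero (sub_ne_zero.2 hbc.symm) (hμ i)
  have hainj : Function.Injective a := fun i j hij =>
    hμinj (Units.ext (mul_right_cancel₀ (hac j) (by rw [← hab j, ← hij, hab i])))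
  have hG := colsIndep_G1matInf hk1 H μ hμH hlam hainj hab hac
  exact ⟨hG, hG.finrank_rowSpan (by omega), hG.minDist_rowSpan (by omega) (by omega)⟩
end

section
/- Assume the subgroup construction with 2 ≤ k ≤ n−1, λ_1, λ_2 ∉ H, and λ_1 ≠ λ_2. Then every k columns of G_2(b,c) are linearly independent; that is, C_2(b,c) is an MDS code of length n+1, dimension k, and minimum Hamming distance n − k + 2. -/
open Matrix Finset

open Polynomial in
/-- A nonzero polynomial of degree less than `k` has fewer than `k` zeros in any finite set. -/
lemma card_lt_of_eval_eq_zero {F : Type*} [Field F] {k : ℕ} {f : F[X]} (hf : f ≠ 0)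
    (hdeg : f.degree < k) (T : Finset F) (hT : ∀ x ∈ T, f.eval x = 0) : T.card < k := by
  by_contra! h
  exact hf (eq_zero_of_degree_lt_of_eval_finset_eq_zero T
    (hdeg.trans_le (by exact_mod_cast h)) hT)

open Polynomial in
/-- If `f ≠ 0` of degree less than `k` vanishes on `T`, `b - x = ν x * (c - x)` for `x ∈ T`, and
`f b = l * f c` with `l` not the product of the `ν x`, then `T` has fewer than `k - 1` points. -/
lemma card_add_one_lt_of_twisted {F : Type*} [Field F] [DecidableEq F] {k : ℕ} {f : F[X]}
    (hf : f ≠ 0) (hdeg : f.degree < k) (T : Finset F) (hT : ∀ x ∈ T, f.eval x = 0)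
    {b c l : F} (hcT : c ∉ T) (ν : F → F) (hν : ∀ x ∈ T, b - x = ν x * (c - x))
    (hl : ∏ x ∈ T, ν x ≠ l) (hbc : f.eval b = l * f.eval c) : T.card + 1 < k := by
  by_contra! h
  have hTk : T.card < k := card_lt_of_eval_eq_zero hf hdeg T hT
  have hcard : (insert c T).card = k := by rw [card_insert_of_notMem hcT]; omega
  set g : F[X] := ∏ x ∈ T, (X - C x) with hg
  have hgdeg : g.degree < k := by
    rw [hg, degree_prod]
    simpa using hTk
  have hgc : g.eval c ≠ 0 := by
    rw [hg, eval_prod, prod_ne_zero_iff]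
    intro x hx
    simpa [sub_eq_zero] using fun h : c = x => hcT (h ▸ hx)
  have hgb : g.eval b = (∏ x ∈ T, ν x) * g.eval c := by
    rw [hg, eval_prod, eval_prod, ← prod_mul_distrib]
    exact prod_congr rfl fun x hx => by simpa using hν x hx
  have hzero : f.eval c • g - g.eval c • f = 0 := by
    refine eq_zero_of_degree_lt_of_eval_finset_eq_zero (insert c T) ?_ ?_
    · rw [hcard]
      refine (degree_sub_le _ _).trans_lt (max_lt ?_ ?_)
      · exact (degree_smul_le _ _).trans_lt hgdeg
      · exact (degree_smul_le _ _).trans_lt hdeg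
    · intro x hx
      rcases mem_insert.1 hx with rfl | hx
      · simp [mul_comm]
      · have : g.eval x = 0 := by
          rw [hg, eval_prod]
          exact prod_eq_zero hx (by simp)
        simp [this, hT x hx]
  have hfc : f.eval c = 0 := by
    have := congrArg (eval b) hzero
    simp only [eval_sub, eval_smul, smul_eq_mul, eval_zero, hgb, hbc] at this
    have h' : f.eval c * (g.eval c * (∏ x ∈ T, ν x - l)) = 0 := by linear_combination this
    exact (mul_eq_zero.1 h').resolve_right (mul_ne_zero hgc (sub_ne_zero.2 hl))
  refine (card_lt_of_eval_eq_zero hf hdeg (insert c T) ?_).ne hcard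
  simpa [hfc] using hT

lemma rowSpan_eq_range {F : Type*} [Field F] {k N : ℕ} (G : Matrix (Fin k) (Fin N) F) :
    rowSpan G = LinearMap.range G.vecMulLinear :=
  (range_vecMulLinear G).symm

/-- Some nonzero combination of the `k` rows of `G` vanishes on any fewer than `k` prescribed
coordinates. -/
lemma exists_ne_zero_vecMul_eq_zero_on {F : Type*} [Field F] {k N : ℕ}
    (G : Matrix (Fin k) (Fin N) F) (T : Finset (Fin N))
    (hT : T.card < k) : ∃ x ≠ 0, ∀ j ∈ T, (x ᵥ* G) j = 0 := by
  let φ : (Fin k → F) →ₗ[F] (T → F) := LinearMap.funLeft F F (↑) ∘ₗ G.vecMulLinear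
  have hker : LinearMap.ker φ ≠ ⊥ := LinearMap.ker_ne_bot_of_finrank_lt (by simpa using hT)
  obtain ⟨x, hx, hx0⟩ := Submodule.exists_mem_ne_zero_of_ne_bot hker
  exact ⟨x, hx0, fun j hj => congrFun (LinearMap.mem_ker.1 hx) ⟨j, hj⟩⟩

section MDS

variable {F : Type*} [Field F] [DecidableEq F] {k N : ℕ} {G : Matrix (Fin k) (Fin N) F}

lemma colsIndep_of_card_zeros_lt
    (h : ∀ x ≠ 0, #{j | (x ᵥ* G) j = 0} < k) : colsIndep G := by
  intro e he hdet
  obtain ⟨x, hx, hxe⟩ := exists_vecMul_eq_zero_iff.2 hdet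
  refine (h x hx).not_ge ?_
  calc k = #(univ.image e) := by simp [card_image_of_injective _ he]
    _ ≤ _ := card_le_card fun j hj => by
      obtain ⟨i, -, rfl⟩ := mem_image.1 hj
      simpa [vecMul, dotProduct] using congrFun hxe i

lemma vecMulLinear_injective_of_card_zeros_lt (hkN : k ≤ N)
    (h : ∀ x ≠ 0, #{j | (x ᵥ* G) j = 0} < k) : Function.Injective G.vecMulLinear := by
  refine (injective_iff_map_eq_zero _).2 fun x hx => ?_
  by_contra hx0
  have hG : x ᵥ* G = 0 := hx
  have := h x hx0
  simp [hG] at this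
  omega

lemma finrank_rowSpan_of_card_zeros_lt (hkN : k ≤ N)
    (h : ∀ x ≠ 0, #{j | (x ᵥ* G) j = 0} < k) : Module.finrank F (rowSpan G) = k := by
  rw [rowSpan_eq_range,
    LinearMap.finrank_range_of_inj (vecMulLinear_injective_of_card_zeros_lt hkN h)]
  simp

lemma card_zeros_add_hammingNorm (w : Fin N → F) : #{j | w j = 0} + hammingNorm w = N := by
  simpa [hammingNorm] using
    card_filter_add_card_filter_not (s := (univ : Finset (Fin N))) (fun j => w j = 0)

lemma minDist_rowSpan_of_card_zeros_lt (hk : 0 < k) (hkN : k ≤ N)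
    (h : ∀ x ≠ 0, #{j | (x ᵥ* G) j = 0} < k) : minDist (rowSpan G) = N - k + 1 := by
  have hlow : ∀ x ≠ 0, N - k + 1 ≤ hammingNorm (x ᵥ* G) := fun x hx => by
    have := card_zeros_add_hammingNorm (x ᵥ* G)
    have := h x hx
    omega
  obtain ⟨T, -, hT⟩ := exists_subset_card_eq (s := (univ : Finset (Fin N))) (n := k - 1)
    (by simp; omega)
  obtain ⟨x, hx, hxT⟩ := exists_ne_zero_vecMul_eq_zero_on G T (by omega)
  have hup : hammingNorm (x ᵥ* G) = N - k + 1 := by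
    refine le_antisymm ?_ (hlow x hx)
    have hle : #T ≤ #{j | (x ᵥ* G) j = 0} := card_le_card fun j hj => by simpa using hxT j hj
    have := card_zeros_add_hammingNorm (x ᵥ* G)
    omega
  rw [minDist, rowSpan_eq_range]
  refine IsLeast.csInf_eq ⟨⟨x ᵥ* G, ⟨x, rfl⟩, ?_, hup⟩, ?_⟩
  · rw [← hammingNorm_ne_zero_iff, hup]
    omega
  · rintro d ⟨_, ⟨y, rfl⟩, hy0, rfl⟩
    exact hlow y fun hy => hy0 (by simp [hy])

end MDS

lemma sum_mul_pow_eq_eval {F : Type*} [Field F] {k : ℕ} (x : Fin k → F) (t : F) :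
    ∑ s, x s * t ^ (s : ℕ) = ((Polynomial.degreeLTEquiv F k).symm x : Polynomial F).eval t := by
  rw [Polynomial.eval_eq_sum_degreeLTEquiv (Subtype.property _)]
  simp

open Polynomial in
lemma exists_polynomial_vecMul_G2mat {F : Type*} [Field F] {k m : ℕ} (a : Fin m → F)
    (b c l1 l2 : F) {x : Fin k → F} (hx : x ≠ 0) :
    ∃ f : F[X], f ≠ 0 ∧ f.degree < k ∧
      (∀ i : Fin m, (x ᵥ* G2mat k m a b c l1 l2) i.castSucc.castSucc = f.eval (a i)) ∧
      (x ᵥ* G2mat k m a b c l1 l2) (Fin.last m).castSucc = f.eval b - l1 * f.eval c ∧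
      (x ᵥ* G2mat k m a b c l1 l2) (Fin.last (m + 1)) = f.eval b - l2 * f.eval c := by
  refine ⟨(degreeLTEquiv F k).symm x, by simpa using hx,
    mem_degreeLT.1 (Subtype.property _), fun i => ?_, ?_, ?_⟩
  all_goals
    simp only [← sum_mul_pow_eq_eval, vecMul, dotProduct, G2mat, of_apply]
    simp [mul_sub, sum_sub_distrib, mul_sum, mul_left_comm]

lemma card_zeros_vecMul_G2mat_lt {F : Type*} [Field F] [DecidableEq F] {m k : ℕ}
    (H : Subgroup Fˣ) (μ : Fin m → Fˣ)
    (hμH : ∀ i, μ i ∈ H) (hμ1 : ∀ i, μ i ≠ 1) (hμinj : Function.Injective μ)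
    {b c l1 l2 : F} (hbc : b ≠ c) (hl : l1 ≠ l2)
    (hl1 : ∀ u : Fˣ, u ∈ H → (u : F) ≠ l1) (hl2 : ∀ u : Fˣ, u ∈ H → (u : F) ≠ l2)
    {a : Fin m → F} (ha : ∀ i, a i = (b - (μ i : F) * c) / (1 - (μ i : F)))
    {x : Fin k → F} (hx : x ≠ 0) :
    #{j | (x ᵥ* G2mat k m a b c l1 l2) j = 0} < k := by
  obtain ⟨f, hf, hdeg, hfa, hf1, hf2⟩ := exists_polynomial_vecMul_G2mat a b c l1 l2 hx
  have hμ1' : ∀ i, (1 : F) - μ i ≠ 0 := fun i h =>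
    hμ1 i (Units.ext (by simpa using (sub_eq_zero.1 h).symm))
  have hba : ∀ i, b - a i = μ i * (c - a i) := fun i => by
    have := hμ1' i
    rw [ha]; field_simp; ring
  have hca : ∀ i, c ≠ a i := fun i h => hbc <| by
    have := hba i
    rw [← h, sub_self, mul_zero] at this
    exact sub_eq_zero.1 this
  have hba' : ∀ i, b ≠ a i := fun i h => by
    have := hba i
    rw [← h, sub_self] at this
    exact mul_ne_zero (μ i).ne_zero (sub_ne_zero.2 hbc.symm) this.symm
  have hainj : Function.Injective a := fun i j hij => hμinj <| Units.ext <|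
    mul_right_cancel₀ (sub_ne_zero.2 (hca j)) <| by rw [← hba j, ← hij, ← hba i]
  set S : Finset (Fin m) := {i | f.eval (a i) = 0} with hS
  have hSk : #(S.image a) = #S := card_image_of_injective _ hainj
  have hSz : ∀ t ∈ S.image a, f.eval t = 0 := by simp [hS]
  have hcS : c ∉ S.image a := by simpa using fun i _ h => hca i h.symm
  have hbS : b ∉ S.image a := by simpa using fun i _ h => hba' i h.symm
  have htwist : ∀ l : F, (∀ u : Fˣ, u ∈ H → (u : F) ≠ l) → f.eval b - l * f.eval c = 0 →
      #S + 1 < k := fun l hl h => by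
    rw [← hSk]
    refine card_add_one_lt_of_twisted hf hdeg (S.image a) hSz hcS
      (fun t => (b - t) / (c - t)) (fun t ht => ?_) ?_ (sub_eq_zero.1 h)
    · exact (div_mul_cancel₀ _ (sub_ne_zero.2 fun h : c = t => hcS (h ▸ ht))).symm
    · rw [prod_image hainj.injOn]
      have : ∏ i ∈ S, (b - a i) / (c - a i) = ((∏ i ∈ S, μ i : Fˣ) : F) := by
        rw [Units.coe_prod]
        exact prod_congr rfl fun i _ => by
          rw [hba, mul_div_cancel_right₀ _ (sub_ne_zero.2 (hca i))]
      rw [this]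
      exact hl _ (H.prod_mem fun i _ => hμH i)
  rw [card_filter, Fin.sum_univ_castSucc, Fin.sum_univ_castSucc]
  simp only [hfa, hf1, hf2]
  rw [← card_filter, ← hS]
  split_ifs with h1 h2 h2
  · have hc0 : f.eval c = 0 := by
      have : (l2 - l1) * f.eval c = 0 := by linear_combination h1 - h2
      exact (mul_eq_zero.1 this).resolve_left (sub_ne_zero.2 hl.symm)
    have hb0 : f.eval b = 0 := by simpa [hc0] using h1
    have := card_lt_of_eval_eq_zero hf hdeg (insert b (insert c (S.image a)))
      (by simpa [hb0, hc0] using hSz)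
    rwa [card_insert_of_notMem (by simpa [hbc] using hbS), card_insert_of_notMem hcS, hSk] at this
  · exact htwist l1 hl1 h1
  · exact htwist l2 hl2 h2
  · exact hSk ▸ card_lt_of_eval_eq_zero hf hdeg _ hSz

/-- Subgroup construction (`n = m+1`): `H ≤ Fˣ`, the `μ_i` are
pairwise distinct elements of `H \ {1}`, `b ≠ c`, `a_i = (b - μ_i c)/(1 - μ_i)`,
`λ_1, λ_2 ∉ H`, `λ_1 ≠ λ_2`. Then for `2 ≤ k ≤ n-1` every `k` columns of `G_2(b,c)`
are linearly independent; that is, `C_2(b,c)` is an MDS code of length `n+1`,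
dimension `k`, and minimum Hamming distance `n - k + 2`. -/
theorem C2_subgroup_MDS {F : Type*} [Field F] [Fintype F] [DecidableEq F] (m k : ℕ)
    (hk1 : 2 ≤ k) (hkm : k ≤ m)
    (H : Subgroup Fˣ) (μ : Fin m → Fˣ)
    (hμH : ∀ i, μ i ∈ H) (hμ1 : ∀ i, μ i ≠ 1) (hμinj : Function.Injective μ)
    (b c l1 l2 : F) (hbc : b ≠ c) (hl : l1 ≠ l2)
    (hl1 : ∀ u : Fˣ, u ∈ H → (u : F) ≠ l1) (hl2 : ∀ u : Fˣ, u ∈ H → (u : F) ≠ l2)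
    (a : Fin m → F) (ha : ∀ i, a i = (b - (μ i : F) * c) / (1 - (μ i : F))) :
    colsIndep (G2mat k m a b c l1 l2) ∧
      Module.finrank F (rowSpan (G2mat k m a b c l1 l2)) = k ∧
      minDist (rowSpan (G2mat k m a b c l1 l2)) = (m + 2) - k + 1 := by
  have hzeros : ∀ x ≠ 0, #{j | (x ᵥ* G2mat k m a b c l1 l2) j = 0} < k := fun x hx =>
    card_zeros_vecMul_G2mat_lt H μ hμH hμ1 hμinj hbc hl hl1 hl2 ha hx
  exact ⟨colsIndep_of_card_zeros_lt hzeros,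
    finrank_rowSpan_of_card_zeros_lt (by omega) hzeros,
    minDist_rowSpan_of_card_zeros_lt (by omega) (by omega) hzeros⟩
end

section
/- Assume the subgroup construction with 3 ≤ k and 2k ≤ n, λ_1, λ_2 ∉ H, λ_1 ≠ λ_2, and λ_1, λ_2 ≠ 0. Then the Schur square code C_2(b,c)^2 has dimension exactly 2k over F. -/
open Matrix Finset

open Polynomial in
/-- The linear map sending a polynomial to its values at the `a_j`, followed by the two twisted
values `f(b) - λ_i f(c)`. -/
def twistedEval {F : Type*} [Field F] (m : ℕ) (a : Fin m → F) (b c l1 l2 : F) :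
    F[X] →ₗ[F] (Fin (m + 2) → F) where
  toFun f j :=
    if h : (j : ℕ) < m then f.eval (a ⟨j, h⟩)
    else if (j : ℕ) = m then f.eval b - l1 * f.eval c
    else f.eval b - l2 * f.eval c
  map_add' f g := by
    ext j
    simp only [Pi.add_apply, eval_add]
    split_ifs <;> ring
  map_smul' r f := by
    ext j
    simp only [Pi.smul_apply, eval_smul, smul_eq_mul, RingHom.id_apply]
    split_ifs <;> ring

open Polynomial in
/-- The linear map through which products of twisted evaluations factor: the pair
`(f g, f(b) g(c) + f(c) g(b))` determines the product of the twisted evaluations of `f`, `g`. -/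
def twistedSquareEval {F : Type*} [Field F] (m : ℕ) (a : Fin m → F) (b c l1 l2 : F) :
    (F[X] × F) →ₗ[F] (Fin (m + 2) → F) where
  toFun p j :=
    if h : (j : ℕ) < m then p.1.eval (a ⟨j, h⟩)
    else if (j : ℕ) = m then p.1.eval b + l1 ^ 2 * p.1.eval c - l1 * p.2
    else p.1.eval b + l2 ^ 2 * p.1.eval c - l2 * p.2
  map_add' p q := by
    ext j
    simp only [Pi.add_apply, Prod.fst_add, Prod.snd_add, eval_add]
    split_ifs <;> ring
  map_smul' r p := by
    ext j
    simp only [Pi.smul_apply, Prod.smul_fst, Prod.smul_snd, eval_smul, smul_eq_mul,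
      RingHom.id_apply]
    split_ifs <;> ring

section

open Polynomial

variable {F : Type*} [Field F] {m : ℕ} (a : Fin m → F) (b c l1 l2 : F)

lemma twistedEval_mul_twistedEval (f g : F[X]) :
    twistedEval m a b c l1 l2 f * twistedEval m a b c l1 l2 g =
      twistedSquareEval m a b c l1 l2
        (f * g, f.eval b * g.eval c + f.eval c * g.eval b) := by
  ext j
  simp only [twistedEval, twistedSquareEval, LinearMap.coe_mk, AddHom.coe_mk, Pi.mul_apply,
    eval_mul]
  split_ifs <;> ring

lemma rowSpan_G2mat (k : ℕ) :
    rowSpan (G2mat k m a b c l1 l2) =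
      (degreeLT F k).map (twistedEval m a b c l1 l2) := by
  classical
  rw [degreeLT_eq_span_X_pow, Submodule.map_span, rowSpan]
  congr 1
  have h (s : ℕ) : twistedEval m a b c l1 l2 (X ^ s) = fun j : Fin (m + 2) =>
      if h : (j : ℕ) < m then a ⟨j, h⟩ ^ s
      else if (j : ℕ) = m then b ^ s - l1 * c ^ s else b ^ s - l2 * c ^ s := by
    ext j
    simp [twistedEval]
  ext x
  simp only [Set.mem_range, Set.mem_image, Finset.coe_image, Finset.coe_range, Set.mem_Iio,
    exists_exists_and_eq_and, h]
  constructor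
  · rintro ⟨s, rfl⟩
    exact ⟨s, s.2, rfl⟩
  · rintro ⟨s, hs, rfl⟩
    exact ⟨⟨s, hs⟩, rfl⟩

lemma mul_mem_degreeLT {k : ℕ} {f g : F[X]} (hf : f ∈ degreeLT F k) (hg : g ∈ degreeLT F k) :
    f * g ∈ degreeLT F (2 * k - 1) := by
  rcases eq_or_ne f 0 with rfl | hf0
  · simp
  rcases eq_or_ne g 0 with rfl | hg0
  · simp
  rw [mem_degreeLT, ← natDegree_lt_iff_degree_lt (by assumption)] at hf hg
  rw [mem_degreeLT, ← natDegree_lt_iff_degree_lt (mul_ne_zero hf0 hg0), natDegree_mul hf0 hg0]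
  omega

lemma schurMul_rowSpan_G2mat {k : ℕ} (hk : 3 ≤ k) (hbc : b ≠ c) :
    schurMul (rowSpan (G2mat k m a b c l1 l2)) (rowSpan (G2mat k m a b c l1 l2)) =
      ((degreeLT F (2 * k - 1)).prod ⊤).map (twistedSquareEval m a b c l1 l2) := by
  classical
  rw [rowSpan_G2mat]
  apply le_antisymm
  · refine Submodule.span_le.2 ?_
    rintro _ ⟨_, ⟨f, hf, rfl⟩, _, ⟨g, hg, rfl⟩, rfl⟩
    rw [twistedEval_mul_twistedEval]
    exact Submodule.mem_map_of_mem ⟨mul_mem_degreeLT hf hg, trivial⟩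
  rw [Submodule.map_le_iff_le_comap]
  set N := Submodule.comap (twistedSquareEval m a b c l1 l2) (schurMul
    ((degreeLT F k).map (twistedEval m a b c l1 l2))
    ((degreeLT F k).map (twistedEval m a b c l1 l2)))
  have hN {f g : F[X]} (hf : f ∈ degreeLT F k) (hg : g ∈ degreeLT F k) :
      (f * g, f.eval b * g.eval c + f.eval c * g.eval b) ∈ N := by
    rw [Submodule.mem_comap, ← twistedEval_mul_twistedEval]
    exact Submodule.subset_span
      ⟨_, Submodule.mem_map_of_mem hf, _, Submodule.mem_map_of_mem hg, rfl⟩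
  have hdeg {f : F[X]} {d : ℕ} (hf : f.degree ≤ d) (hd : d < k) : f ∈ degreeLT F k :=
    mem_degreeLT.2 (hf.trans_lt (by exact_mod_cast hd))
  have hsnd (s : F) : ((0 : F[X]), s) ∈ N := by
    have h1 := hN (f := (X - C b) * (X - C c)) (g := 1)
      (hdeg (d := 2) (by rw [degree_mul, degree_X_sub_C, degree_X_sub_C]; rfl) (by omega))
      (hdeg (d := 0) (by simp) (by omega))
    have h2 := hN (f := X - C b) (g := X - C c)
      (hdeg (d := 1) (degree_X_sub_C b).le (by omega))
      (hdeg (d := 1) (degree_X_sub_C c).le (by omega))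
    have h3 := N.smul_mem (s / ((b - c) * (b - c))) (N.sub_mem h1 h2)
    have hbc' : b - c ≠ 0 := sub_ne_zero.2 hbc
    convert h3 using 1
    ext1
    · simp
    · simp
      field_simp
      ring
  have hfst {h : F[X]} (hh : h ∈ degreeLT F (2 * k - 1)) : (h, (0 : F)) ∈ N := by
    suffices degreeLT F (2 * k - 1) ≤ N.comap (LinearMap.inl F F[X] F) from this hh
    rw [degreeLT_eq_span_X_pow, Submodule.span_le]
    intro x hx
    simp only [Finset.coe_image, Finset.coe_range, Set.mem_image, Set.mem_Iio] at hx
    obtain ⟨i, hi, rfl⟩ := hx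
    obtain ⟨s, t, hs, ht, rfl⟩ : ∃ s t, s < k ∧ t < k ∧ i = s + t :=
      ⟨min i (k - 1), i - min i (k - 1), by omega, by omega, by omega⟩
    have h1 := N.sub_mem
      (hN (hdeg (degree_X_pow_le (R := F) s) hs) (hdeg (degree_X_pow_le (R := F) t) ht))
      (hsnd (eval b (X ^ s) * eval c (X ^ t) + eval c (X ^ s) * eval b (X ^ t)))
    simpa [pow_add] using h1
  rintro ⟨h, s⟩ ⟨hh, -⟩
  simpa using N.add_mem (hfst hh) (hsnd s)

lemma finrank_map_twistedSquareEval {d : ℕ} (hd : d ≤ m) (ha : Function.Injective a)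
    (hl1 : l1 ≠ 0) :
    Module.finrank F (((degreeLT F d).prod ⊤).map (twistedSquareEval m a b c l1 l2)) =
      d + 1 := by
  let φ := (twistedSquareEval m a b c l1 l2).comp
    ((degreeLT F d).subtype.prodMap (LinearMap.id (M := F)))
  have hφ : Function.Injective φ := by
    rw [← LinearMap.ker_eq_bot, LinearMap.ker_eq_bot']
    rintro ⟨⟨h, hh⟩, s⟩ h0
    have hval (j : Fin (m + 2)) := congrFun h0 j
    simp only [φ, twistedSquareEval, LinearMap.comp_apply, LinearMap.coe_mk, AddHom.coe_mk,
      LinearMap.prodMap_apply, Submodule.subtype_apply, LinearMap.id_apply,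
      Pi.zero_apply] at hval
    have hz : h = 0 := by
      refine eq_zero_of_degree_lt_of_eval_index_eq_zero (s := Finset.univ) (v := a)
        ha.injOn ?_ ?_
      · refine (mem_degreeLT.1 hh).trans_le ?_
        simpa using hd
      · intro i _
        simpa using hval ⟨i, by omega⟩
    subst hz
    have hs := hval ⟨m, by omega⟩
    simp only [lt_irrefl, dite_false, if_true, eval_zero] at hs
    have : s = 0 := by simpa [hl1] using hs
    subst this
    rfl
  have hrange : LinearMap.range φ =
      ((degreeLT F d).prod ⊤).map (twistedSquareEval m a b c l1 l2) := by
    rw [LinearMap.range_comp, LinearMap.range_prodMap, Submodule.range_subtype,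
      LinearMap.range_id]
  have : Module.Finite F (degreeLT F d) := Module.Finite.equiv (degreeLTEquiv F d).symm
  rw [← hrange, LinearMap.finrank_range_of_inj hφ, Module.finrank_prod,
    (degreeLTEquiv F d).finrank_eq, Module.finrank_fin_fun, Module.finrank_self]

end

/-- The points of the subgroup construction are pairwise distinct. -/
lemma injective_of_subgroup_construction {F ι : Type*} [Field F] {μ : ι → Fˣ}
    (hμ1 : ∀ i, μ i ≠ 1) (hμinj : Function.Injective μ) {b c : F} (hbc : b ≠ c)
    {a : ι → F} (ha : ∀ i, a i = (b - (μ i : F) * c) / (1 - (μ i : F))) :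
    Function.Injective a := by
  intro i j hij
  have h1 (i : ι) : (1 : F) - μ i ≠ 0 := fun h =>
    hμ1 i (Units.ext (by simpa using (sub_eq_zero.1 h).symm))
  rw [ha, ha, div_eq_div_iff (h1 i) (h1 j)] at hij
  refine hμinj (Units.ext (mul_right_cancel₀ (sub_ne_zero.2 hbc) ?_))
  linear_combination hij

/-- Subgroup construction (`n = m+1`), `3 ≤ k`, `2k ≤ n`,
`λ_1, λ_2 ∉ H`, `λ_1 ≠ λ_2`, `λ_1, λ_2 ≠ 0`. Then the Schur square of `C_2(b,c)` has
dimension exactly `2k`. -/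
theorem C2_schur_square_dim {F : Type*} [Field F] [Fintype F] (m k : ℕ)
    (hk3 : 3 ≤ k) (hkn : 2 * k ≤ m + 1)
    (H : Subgroup Fˣ) (μ : Fin m → Fˣ)
    (hμH : ∀ i, μ i ∈ H) (hμ1 : ∀ i, μ i ≠ 1) (hμinj : Function.Injective μ)
    (b c l1 l2 : F) (hbc : b ≠ c) (hl : l1 ≠ l2) (hl10 : l1 ≠ 0) (hl20 : l2 ≠ 0)
    (hl1 : ∀ u : Fˣ, u ∈ H → (u : F) ≠ l1) (hl2 : ∀ u : Fˣ, u ∈ H → (u : F) ≠ l2)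
    (a : Fin m → F) (ha : ∀ i, a i = (b - (μ i : F) * c) / (1 - (μ i : F))) :
    Module.finrank F
      (schurMul (rowSpan (G2mat k m a b c l1 l2)) (rowSpan (G2mat k m a b c l1 l2)))
      = 2 * k := by
  rw [schurMul_rowSpan_G2mat a b c l1 l2 hk3 hbc,
    finrank_map_twistedSquareEval a b c l1 l2 (by omega)
      (injective_of_subgroup_construction hμ1 hμinj hbc ha) hl10]
  omega
end
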